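/- arXiv:2601.15815 — 2 statements merged into one kernel-verified Lean document; each statement's English description precedes it below -/
import Mathlib

section
/- For fixed $s \in (0,1)$ and every $x>0$, $y \in \mathbb{R}$, the Poisson-type average satisfies $\frac{1}{\pi}\int_{-\infty}^{+\infty} \frac{x}{x^2+t^2}\,|y+t|^s\,dt \geq |y|^s$. -/
open MeasureTheory

section PoissonKernel

open Real Set Filter Topology

theorem integrable_poissonKernel {x : ℝ} (hx : 0 < x) :
    Integrable fun t : ℝ => x / (x ^ 2 + t ^ 2) := by
  refine ((integrable_inv_one_add_sq.comp_div hx.ne').const_mul x⁻¹).congr (.of_forall fun t => ?_)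
  simp only
  field_simp

theorem integral_poissonKernel {x : ℝ} (hx : 0 < x) :
    ∫ t : ℝ, x / (x ^ 2 + t ^ 2) = π := by
  have h : ∀ t : ℝ, x / (x ^ 2 + t ^ 2) = x⁻¹ * (1 + (t / x) ^ 2)⁻¹ := fun t => by field_simp
  simp_rw [h, integral_const_mul]
  rw [Measure.integral_comp_div (fun t : ℝ => (1 + t ^ 2)⁻¹) x, integral_univ_inv_one_add_sq,
    abs_of_pos hx, smul_eq_mul, inv_mul_cancel_left₀ hx.ne']

theorem tendsto_log_sq_add_sub_log_sq_add {l : Filter ℝ} (hl : Tendsto (fun t : ℝ => t⁻¹) l (𝓝 0))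
    (hl0 : ∀ᶠ t in l, t ≠ 0) {x a : ℝ} (hx : 0 < x) (ha : 0 < a) (y : ℝ) :
    Tendsto (fun t => log (t ^ 2 + x ^ 2) - log ((t + y) ^ 2 + a ^ 2)) l (𝓝 0) := by
  have hc : ContinuousAt
      (fun w : ℝ => log ((1 + x ^ 2 * w ^ 2) / ((1 + y * w) ^ 2 + a ^ 2 * w ^ 2))) 0 := by
    refine ContinuousAt.log (ContinuousAt.div (by fun_prop) (by fun_prop) ?_) ?_ <;> norm_num
  have h := hc.tendsto.comp hl
  norm_num at h
  refine h.congr' ?_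
  filter_upwards [hl0] with t ht
  have h1 : 0 < t ^ 2 + x ^ 2 := by positivity
  have h2 : 0 < (t + y) ^ 2 + a ^ 2 := by positivity
  rw [← log_div h1.ne' h2.ne']
  simp only [Function.comp_apply]
  congr 1
  have h3 : (1 + y * t⁻¹) ^ 2 + a ^ 2 * (t⁻¹) ^ 2 = ((t + y) ^ 2 + a ^ 2) / t ^ 2 := by
    field_simp
  rw [h3]
  field_simp

theorem integrable_poissonKernel_mul_poissonKernel {x a : ℝ} (hx : 0 < x) (ha : 0 < a) (y : ℝ) :
    Integrable fun t : ℝ => x / (x ^ 2 + t ^ 2) * (a / ((y + t) ^ 2 + a ^ 2)) := by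
  refine (integrable_poissonKernel hx).mul_bdd (c := a⁻¹)
    (Measurable.aestronglyMeasurable (by fun_prop)) (.of_forall fun t => ?_)
  rw [norm_of_nonneg (by positivity), div_le_iff₀ (by positivity)]
  field_simp
  nlinarith [sq_nonneg (y + t)]

/-- The semigroup property of the Poisson kernel, away from `y = 0`. -/
theorem integral_poissonKernel_mul_poissonKernel {x a y : ℝ} (hx : 0 < x) (ha : 0 < a)
    (hy : y ≠ 0) :
    ∫ t : ℝ, x / (x ^ 2 + t ^ 2) * (a / ((y + t) ^ 2 + a ^ 2)) =
      π * ((a + x) / ((a + x) ^ 2 + y ^ 2)) := by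
  have hD1 : 0 < (a + x) ^ 2 + y ^ 2 := by positivity
  have hD2 : 0 < (a - x) ^ 2 + y ^ 2 := by positivity
  set E : ℝ := a * x / (((a + x) ^ 2 + y ^ 2) * ((a - x) ^ 2 + y ^ 2)) with hE
  have hED : E * (((a + x) ^ 2 + y ^ 2) * ((a - x) ^ 2 + y ^ 2)) = a * x := by
    rw [hE]; field_simp
  set B : ℝ := (y ^ 2 + a ^ 2 - x ^ 2) * E / x with hB
  set C : ℝ := (y ^ 2 - a ^ 2 + x ^ 2) * E / a with hC
  have hderiv : ∀ t : ℝ, HasDerivAt (fun t : ℝ =>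
      (-y * E) * (log (t ^ 2 + x ^ 2) - log ((t + y) ^ 2 + a ^ 2))
        + B * arctan (t / x) + C * arctan ((t + y) / a))
      (x / (x ^ 2 + t ^ 2) * (a / ((y + t) ^ 2 + a ^ 2))) t := by
    intro t
    have h1 : 0 < t ^ 2 + x ^ 2 := by positivity
    have h2 : 0 < (t + y) ^ 2 + a ^ 2 := by positivity
    have d1 : HasDerivAt (fun t : ℝ => log (t ^ 2 + x ^ 2)) (2 * t / (t ^ 2 + x ^ 2)) t := by
      refine HasDerivAt.log ?_ h1.ne'
      simpa using ((hasDerivAt_id' t).fun_pow 2).add_const (x ^ 2)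
    have d2 : HasDerivAt (fun t : ℝ => log ((t + y) ^ 2 + a ^ 2))
        (2 * (t + y) / ((t + y) ^ 2 + a ^ 2)) t := by
      refine HasDerivAt.log ?_ h2.ne'
      simpa using (((hasDerivAt_id' t).add_const y).fun_pow 2).add_const (a ^ 2)
    have d3 := ((hasDerivAt_id' t).div_const x).arctan
    have d4 := (((hasDerivAt_id' t).add_const y).div_const a).arctan
    refine ((((d1.sub d2).const_mul (-y * E)).add (d3.const_mul B)).add
      (d4.const_mul C)).congr_deriv ?_
    have e1 : B * (1 / (1 + (t / x) ^ 2) * (1 / x)) =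
        (y ^ 2 + a ^ 2 - x ^ 2) * E / (t ^ 2 + x ^ 2) := by
      rw [hB]; field_simp; ring
    have e2 : C * (1 / (1 + ((t + y) / a) ^ 2) * (1 / a)) =
        (y ^ 2 - a ^ 2 + x ^ 2) * E / ((t + y) ^ 2 + a ^ 2) := by
      rw [hC]; field_simp; ring
    have e3 : x / (x ^ 2 + t ^ 2) * (a / ((y + t) ^ 2 + a ^ 2)) =
        a * x / ((t ^ 2 + x ^ 2) * ((t + y) ^ 2 + a ^ 2)) := by
      rw [add_comm (x ^ 2), add_comm y]; field_simp
    rw [e1, e2, e3, ← hED]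
    clear_value E B C
    field_simp
    ring
  have hbot : Tendsto (fun t : ℝ =>
      (-y * E) * (log (t ^ 2 + x ^ 2) - log ((t + y) ^ 2 + a ^ 2))
        + B * arctan (t / x) + C * arctan ((t + y) / a)) atBot
      (𝓝 ((-y * E) * 0 + B * (-(π / 2)) + C * (-(π / 2)))) := by
    have harc := tendsto_nhds_of_tendsto_nhdsWithin tendsto_arctan_atBot
    refine (((tendsto_log_sq_add_sub_log_sq_add tendsto_inv_atBot_zero (eventually_ne_atBot 0)
      hx ha y).const_mul _).add (Tendsto.const_mul _ (harc.comp ?_))).add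
      (Tendsto.const_mul _ (harc.comp ?_))
    · exact tendsto_id.atBot_div_const hx
    · exact (tendsto_atBot_add_const_right _ y tendsto_id).atBot_div_const ha
  have htop : Tendsto (fun t : ℝ =>
      (-y * E) * (log (t ^ 2 + x ^ 2) - log ((t + y) ^ 2 + a ^ 2))
        + B * arctan (t / x) + C * arctan ((t + y) / a)) atTop
      (𝓝 ((-y * E) * 0 + B * (π / 2) + C * (π / 2))) := by
    have harc := tendsto_nhds_of_tendsto_nhdsWithin tendsto_arctan_atTop
    refine (((tendsto_log_sq_add_sub_log_sq_add tendsto_inv_atTop_zero (eventually_ne_atTop 0)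
      hx ha y).const_mul _).add (Tendsto.const_mul _ (harc.comp ?_))).add
      (Tendsto.const_mul _ (harc.comp ?_))
    · exact tendsto_id.atTop_div_const hx
    · exact (tendsto_atTop_add_const_right _ y tendsto_id).atTop_div_const ha
  rw [integral_of_hasDerivAt_of_tendsto hderiv
    (integrable_poissonKernel_mul_poissonKernel hx ha y) hbot htop]
  have key : B + C = (a + x) / ((a + x) ^ 2 + y ^ 2) := by
    rw [hB, hC, hE]
    field_simp
    ring
  rw [← key]
  ring

theorem integrable_poissonKernel_mul_abs_rpow {s x : ℝ} (hs0 : 0 < s) (hs1 : s < 1) (hx : 0 < x)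
    (y : ℝ) : Integrable fun t : ℝ => x / (x ^ 2 + t ^ 2) * |y + t| ^ s := by
  have hb : Integrable fun t : ℝ => (1 + ‖t‖) ^ (-(2 - s)) :=
    integrable_one_add_norm (by simp; linarith)
  refine (hb.const_mul (2 * x * (1 + (x ^ 2)⁻¹) * (|y| + 1) ^ s)).mono'
    (Measurable.aestronglyMeasurable (by fun_prop)) (.of_forall fun t => ?_)
  rw [norm_of_nonneg (by positivity), norm_eq_abs]
  have h1 : |y + t| ^ s ≤ (|y| + 1) ^ s * (1 + |t|) ^ s := by
    rw [← mul_rpow (by positivity) (by positivity)]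
    refine rpow_le_rpow (by positivity) ?_ hs0.le
    nlinarith [abs_add_le y t, abs_nonneg y, abs_nonneg t, mul_nonneg (abs_nonneg y) (abs_nonneg t)]
  have h2 : x / (x ^ 2 + t ^ 2) ≤ 2 * x * (1 + (x ^ 2)⁻¹) * (1 + |t|) ^ (-2 : ℝ) := by
    rw [rpow_neg (by positivity), ← div_eq_mul_inv, div_le_div_iff₀ (by positivity) (by positivity),
      rpow_two]
    have h3 : (1 + |t|) ^ 2 ≤ 2 * ((1 + (x ^ 2)⁻¹) * (x ^ 2 + t ^ 2)) := by
      have : (1 + (x ^ 2)⁻¹) * (x ^ 2 + t ^ 2) = 1 + t ^ 2 + (x ^ 2 + (x ^ 2)⁻¹ * t ^ 2) := by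
        field_simp; ring
      have h4 : 0 ≤ x ^ 2 + (x ^ 2)⁻¹ * t ^ 2 := by positivity
      nlinarith [sq_abs t, sq_nonneg (1 - |t|)]
    nlinarith [mul_le_mul_of_nonneg_left h3 hx.le]
  calc x / (x ^ 2 + t ^ 2) * |y + t| ^ s
      ≤ (2 * x * (1 + (x ^ 2)⁻¹) * (1 + |t|) ^ (-2 : ℝ)) * ((|y| + 1) ^ s * (1 + |t|) ^ s) := by
        gcongr
    _ = 2 * x * (1 + (x ^ 2)⁻¹) * (|y| + 1) ^ s * (1 + |t|) ^ (-(2 - s)) := by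
        rw [show -(2 - s) = -2 + s by ring, rpow_add (by positivity)]
        ring

end PoissonKernel

section AbsRpow

open Real Set Filter Topology

theorem integrableOn_rpow_mul_inv_one_add_sq {s : ℝ} (hs0 : 0 < s) (hs1 : s < 1) :
    IntegrableOn (fun a : ℝ => a ^ (s - 1) * (1 / (1 + a ^ 2))) (Ioi 0) := by
  rw [← Ioc_union_Ioi_eq_Ioi zero_le_one]
  have hm (S : Set ℝ) : AEStronglyMeasurable (fun a : ℝ => a ^ (s - 1) * (1 / (1 + a ^ 2)))
    (volume.restrict S) := Measurable.aestronglyMeasurable (by fun_prop)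
  refine IntegrableOn.union ?_ ?_
  · have h := (intervalIntegral.intervalIntegrable_rpow' (a := 0) (b := 1)
      (show -1 < s - 1 by linarith)).1
    refine Integrable.mono' h (hm _) ?_
    filter_upwards [ae_restrict_mem measurableSet_Ioc] with a ha
    have ha0 := ha.1
    rw [norm_of_nonneg (by positivity)]
    refine mul_le_of_le_one_right (by positivity) ?_
    rw [div_le_one (by positivity)]
    nlinarith [sq_nonneg a]
  · have h := integrableOn_Ioi_rpow_of_lt (show s - 1 - 2 < -1 by linarith) zero_lt_one
    refine Integrable.mono' h (hm _) ?_
    filter_upwards [ae_restrict_mem measurableSet_Ioi] with a ha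
    have ha0 : (0 : ℝ) < a := zero_lt_one.trans ha
    rw [norm_of_nonneg (by positivity), rpow_sub ha0 _ 2, rpow_two,
      div_eq_mul_one_div (a ^ (s - 1))]
    exact mul_le_mul_of_nonneg_left
      (one_div_le_one_div_of_le (by positivity) (by linarith)) (by positivity)

/-- The integral representing `|u| ^ s` as a superposition of `u ^ 2 / (u ^ 2 + a ^ 2)`. -/
theorem integrableOn_rpow_mul_sq_div_and_integral_eq {s : ℝ} (hs0 : 0 < s) (hs1 : s < 1) (u : ℝ) :
    IntegrableOn (fun a : ℝ => a ^ (s - 1) * (u ^ 2 / (u ^ 2 + a ^ 2))) (Ioi 0) ∧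
      ∫ a in Ioi (0 : ℝ), a ^ (s - 1) * (u ^ 2 / (u ^ 2 + a ^ 2)) =
        |u| ^ s * ∫ a in Ioi (0 : ℝ), a ^ (s - 1) * (1 / (1 + a ^ 2)) := by
  rcases eq_or_ne u 0 with rfl | hu
  · simp [zero_rpow hs0.ne']
  have hu' : 0 < |u| := abs_pos.2 hu
  have hscale : EqOn (fun a : ℝ => (|u| * a) ^ (s - 1) * (u ^ 2 / (u ^ 2 + (|u| * a) ^ 2)))
      (fun a : ℝ => |u| ^ (s - 1) * (a ^ (s - 1) * (1 / (1 + a ^ 2)))) (Ioi 0) := by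
    intro a ha
    have ha : 0 < a := ha
    simp only
    rw [mul_rpow hu'.le ha.le, mul_pow, sq_abs]
    field_simp
  constructor
  · have h := integrableOn_Ioi_comp_mul_left_iff
      (fun a : ℝ => a ^ (s - 1) * (u ^ 2 / (u ^ 2 + a ^ 2))) 0 hu'
    rw [mul_zero] at h
    rw [← h]
    exact IntegrableOn.congr_fun
      ((integrableOn_rpow_mul_inv_one_add_sq hs0 hs1).const_mul (|u| ^ (s - 1)))
      hscale.symm measurableSet_Ioi
  · have h := integral_comp_mul_left_Ioi
      (fun a : ℝ => a ^ (s - 1) * (u ^ 2 / (u ^ 2 + a ^ 2))) 0 hu'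
    rw [setIntegral_congr_fun measurableSet_Ioi hscale, integral_const_mul, mul_zero,
      smul_eq_mul] at h
    rw [← mul_inv_cancel_left₀ hu'.ne' (∫ a in Ioi (0 : ℝ), _), ← h, ← mul_assoc]
    congr 1
    rw [rpow_sub_one hu'.ne']
    field_simp

theorem integral_rpow_mul_inv_one_add_sq_pos {s : ℝ} (hs0 : 0 < s) (hs1 : s < 1) :
    0 < ∫ a in Ioi (0 : ℝ), a ^ (s - 1) * (1 / (1 + a ^ 2)) := by
  have hpos : ∀ a ∈ Ioi (0 : ℝ), 0 < a ^ (s - 1) * (1 / (1 + a ^ 2)) := by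
    intro a ha
    have ha : 0 < a := ha
    positivity
  rw [setIntegral_pos_iff_support_of_nonneg_ae
    ((ae_restrict_mem measurableSet_Ioi).mono fun a ha => (hpos a ha).le)
    (integrableOn_rpow_mul_inv_one_add_sq hs0 hs1),
    inter_eq_self_of_subset_right (s := Function.support _) fun a ha => (hpos a ha).ne']
  simp

/-- A translation inequality for the Stieltjes-type integrals of `a / (a ^ 2 + y ^ 2)`. -/
theorem integral_rpow_mul_sub_shift_nonneg {s x y : ℝ} (hs0 : 0 < s) (hs1 : s < 1) (hx : 0 < x)
    (hy : y ≠ 0)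
    (hint : IntegrableOn (fun a : ℝ =>
      a ^ s * (a / (a ^ 2 + y ^ 2) - (a + x) / ((a + x) ^ 2 + y ^ 2))) (Ioi 0)) :
    0 ≤ ∫ a in Ioi (0 : ℝ), a ^ s * (a / (a ^ 2 + y ^ 2) - (a + x) / ((a + x) ^ 2 + y ^ 2)) := by
  have hlim := intervalIntegral_tendsto_integral_Ioi 0 hint tendsto_id
  have hzero : Tendsto (fun R : ℝ => -(x * R ^ (s - 1))) atTop (𝓝 0) := by
    have h := ((tendsto_rpow_neg_atTop (show 0 < 1 - s by linarith)).const_mul x).neg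
    simpa using h
  refine le_of_tendsto_of_tendsto hzero hlim ?_
  filter_upwards [eventually_gt_atTop 0] with R hR
  simp only [id]
  set g : ℝ → ℝ := fun a => a ^ s * (a / (a ^ 2 + y ^ 2)) with hg
  have hgc : Continuous g := by
    refine (continuous_rpow_const hs0.le).mul (continuous_id.div (by fun_prop) fun a => ?_)
    positivity
  have hgi (p q : ℝ) : IntervalIntegrable g volume p q := hgc.intervalIntegrable p q
  have hg0 : ∀ a, 0 ≤ a → 0 ≤ g a := fun a ha => by positivity
  have hshift : IntervalIntegrable (fun a => g (a + x)) volume 0 R :=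
    (hgc.comp (by fun_prop)).intervalIntegrable _ _
  have hle : (∫ a in (0 : ℝ)..R, g a - g (a + x)) ≤
      ∫ a in (0 : ℝ)..R, a ^ s * (a / (a ^ 2 + y ^ 2) - (a + x) / ((a + x) ^ 2 + y ^ 2)) := by
    refine intervalIntegral.integral_mono_on hR.le ((hgi _ _).sub hshift) ?_ fun a ha => ?_
    · rw [intervalIntegrable_iff_integrableOn_Ioc_of_le hR.le]
      exact hint.mono_set Ioc_subset_Ioi_self
    · have ha : 0 ≤ a := ha.1
      rw [mul_sub]
      refine sub_le_sub_left ?_ _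
      exact mul_le_mul_of_nonneg_right (rpow_le_rpow ha (by linarith) hs0.le) (by positivity)
  have htail : (∫ a in R..(R + x), g a) ≤ x * R ^ (s - 1) := by
    have h : (∫ a in R..(R + x), g a) ≤ ∫ _ in R..(R + x), R ^ (s - 1) := by
      refine intervalIntegral.integral_mono_on (by linarith) (hgi _ _) (by simp) fun a ha => ?_
      have ha0 : 0 < a := hR.trans_le ha.1
      refine le_trans ?_ (rpow_le_rpow_of_nonpos hR ha.1 (by linarith))
      rw [rpow_sub_one ha0.ne', div_eq_mul_inv]
      refine mul_le_mul_of_nonneg_left ?_ (by positivity)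
      rw [div_le_iff₀ (by positivity)]
      field_simp
      nlinarith [sq_nonneg y]
    simpa using h
  have hhead : 0 ≤ ∫ a in (0 : ℝ)..x, g a :=
    intervalIntegral.integral_nonneg hx.le fun a ha => hg0 a ha.1
  rw [intervalIntegral.integral_sub (hgi _ _) hshift, intervalIntegral.integral_comp_add_right,
    zero_add] at hle
  have e1 := intervalIntegral.integral_add_adjacent_intervals (hgi 0 x) (hgi x (R + x))
  have e2 := intervalIntegral.integral_add_adjacent_intervals (hgi 0 R) (hgi R (R + x))
  linarith

end AbsRpow

section PoissonAverage

open Real Set Filter Topology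

theorem integral_poissonKernel_mul_sq_div {x a y : ℝ} (hx : 0 < x) (ha : 0 < a) (hy : y ≠ 0) :
    ∫ t : ℝ, x / (x ^ 2 + t ^ 2) * ((y + t) ^ 2 / ((y + t) ^ 2 + a ^ 2)) =
      π * (1 - a * ((a + x) / ((a + x) ^ 2 + y ^ 2))) := by
  have h : ∀ t : ℝ, x / (x ^ 2 + t ^ 2) * ((y + t) ^ 2 / ((y + t) ^ 2 + a ^ 2)) =
      x / (x ^ 2 + t ^ 2) - a * (x / (x ^ 2 + t ^ 2) * (a / ((y + t) ^ 2 + a ^ 2))) := by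
    intro t
    field_simp
    ring
  simp_rw [h]
  rw [integral_sub (integrable_poissonKernel hx)
    ((integrable_poissonKernel_mul_poissonKernel hx ha y).const_mul a), integral_const_mul,
    integral_poissonKernel hx, integral_poissonKernel_mul_poissonKernel hx ha hy]
  ring

theorem integrable_prod_poissonKernel_mul_rpow_mul_sq_div {s x : ℝ} (hs0 : 0 < s) (hs1 : s < 1)
    (hx : 0 < x) (y : ℝ) :
    Integrable (Function.uncurry fun t a : ℝ =>
      x / (x ^ 2 + t ^ 2) * (a ^ (s - 1) * ((y + t) ^ 2 / ((y + t) ^ 2 + a ^ 2))))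
      (volume.prod (volume.restrict (Ioi 0))) := by
  rw [integrable_prod_iff (Measurable.aestronglyMeasurable (by unfold Function.uncurry; fun_prop))]
  refine ⟨.of_forall fun t =>
    (integrableOn_rpow_mul_sq_div_and_integral_eq hs0 hs1 (y + t)).1.const_mul (x / (x ^ 2 + t ^ 2)), ?_⟩
  refine ((integrable_poissonKernel_mul_abs_rpow hs0 hs1 hx y).mul_const
    (∫ a in Ioi (0 : ℝ), a ^ (s - 1) * (1 / (1 + a ^ 2)))).congr (.of_forall fun t => ?_)
  simp only [Function.uncurry]
  rw [mul_assoc, ← (integrableOn_rpow_mul_sq_div_and_integral_eq hs0 hs1 (y + t)).2,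
    ← integral_const_mul]
  refine setIntegral_congr_fun measurableSet_Ioi fun a ha => ?_
  have ha : 0 < a := ha
  exact (norm_of_nonneg (by positivity)).symm

end PoissonAverage

theorem poisson_average_ge (s : ℝ) (hs0 : 0 < s) (hs1 : s < 1)
    (x y : ℝ) (hx : 0 < x) :
    |y| ^ s ≤ (1 / Real.pi) * ∫ t : ℝ, (x / (x ^ 2 + t ^ 2)) * |y + t| ^ s := by
  rcases eq_or_ne y 0 with rfl | hy
  · rw [abs_zero, Real.zero_rpow hs0.ne']
    exact mul_nonneg (by positivity) (integral_nonneg fun t => by positivity)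
  set K : ℝ := ∫ a in Set.Ioi (0 : ℝ), a ^ (s - 1) * (1 / (1 + a ^ 2)) with hK
  have hKpos : 0 < K := integral_rpow_mul_inv_one_add_sq_pos hs0 hs1
  have hprod := integrable_prod_poissonKernel_mul_rpow_mul_sq_div hs0 hs1 hx y
  have hslice : ∀ a ∈ Set.Ioi (0 : ℝ), ∫ t : ℝ, x / (x ^ 2 + t ^ 2) *
      (a ^ (s - 1) * ((y + t) ^ 2 / ((y + t) ^ 2 + a ^ 2))) =
      Real.pi * (a ^ (s - 1) * (1 - a * ((a + x) / ((a + x) ^ 2 + y ^ 2)))) := by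
    intro a ha
    simp_rw [mul_left_comm _ (a ^ (s - 1))]
    rw [integral_const_mul, integral_poissonKernel_mul_sq_div hx ha hy]
  have hswap : (∫ t : ℝ, x / (x ^ 2 + t ^ 2) * |y + t| ^ s) * K =
      Real.pi * ∫ a in Set.Ioi (0 : ℝ),
        a ^ (s - 1) * (1 - a * ((a + x) / ((a + x) ^ 2 + y ^ 2))) := by
    rw [← integral_const_mul Real.pi, ← setIntegral_congr_fun measurableSet_Ioi hslice,
      ← integral_integral_swap hprod, ← integral_mul_const]
    refine integral_congr_ae (.of_forall fun t => ?_)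
    simp only
    rw [integral_const_mul, (integrableOn_rpow_mul_sq_div_and_integral_eq hs0 hs1 (y + t)).2,
      mul_assoc]
  have hint : IntegrableOn (fun a : ℝ =>
      a ^ (s - 1) * (1 - a * ((a + x) / ((a + x) ^ 2 + y ^ 2)))) (Set.Ioi 0) := by
    refine IntegrableOn.congr_fun (hprod.integral_prod_right.const_mul Real.pi⁻¹)
      (fun a ha => ?_) measurableSet_Ioi
    simp only [Function.uncurry]
    rw [hslice a ha, inv_mul_cancel_left₀ Real.pi_ne_zero]
  obtain ⟨hint', hval⟩ := integrableOn_rpow_mul_sq_div_and_integral_eq hs0 hs1 y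
  have hdiff : Set.EqOn (fun a : ℝ => a ^ (s - 1) * (1 - a * ((a + x) / ((a + x) ^ 2 + y ^ 2))) -
      a ^ (s - 1) * (y ^ 2 / (y ^ 2 + a ^ 2)))
      (fun a : ℝ => a ^ s * (a / (a ^ 2 + y ^ 2) - (a + x) / ((a + x) ^ 2 + y ^ 2)))
      (Set.Ioi 0) := by
    intro a ha
    have ha : 0 < a := ha
    simp only
    rw [Real.rpow_sub_one ha.ne', add_comm (y ^ 2)]
    have h1 : 0 < a ^ 2 + y ^ 2 := by positivity
    have h2 : 0 < (a + x) ^ 2 + y ^ 2 := by positivity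
    field_simp
    ring
  have hnonneg := integral_rpow_mul_sub_shift_nonneg hs0 hs1 hx hy
    (IntegrableOn.congr_fun (hint.sub hint') hdiff measurableSet_Ioi)
  rw [← setIntegral_congr_fun measurableSet_Ioi hdiff, integral_sub hint hint', hval,
    sub_nonneg] at hnonneg
  rw [one_div_mul_eq_div, le_div_iff₀ Real.pi_pos]
  refine le_of_mul_le_mul_right ?_ hKpos
  rw [hswap]
  nlinarith [mul_le_mul_of_nonneg_left hnonneg Real.pi_pos.le]
end

section
/- Let $m$ be a measurable function on $\mathbb{R}^n$, $1\leq p<\infty$, and suppose $\|e^{itm}\|_{\mathcal{M}_p} \leq A e^{|t|^s}$ for all $t\in\mathbb{R}$, for some $A>0$ and $0<s<1$. Then for every $\lambda \in \mathbb{R}\setminus\{0\}$, the function $\frac{1}{\lambda + im}$ is a Fourier multiplier on $L^p(\mathbb{R}^n)$. -/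
open MeasureTheory Complex
open scoped FourierTransform ENNReal

/-- `m` is a Fourier multiplier on `Lᵖ(ℝⁿ)` with constant `C`: the operator
`f ↦ (m ⬝ 𝓕 f)ᵛ` satisfies an `Lᵖ` bound with constant `C` on Schwartz functions. -/
def multiplierBound (n : ℕ) (p : ℝ≥0∞) (m : EuclideanSpace ℝ (Fin n) → ℂ) (C : ℝ) : Prop :=
  ∀ f : SchwartzMap (EuclideanSpace ℝ (Fin n)) ℂ,
    eLpNorm (𝓕⁻ fun ξ => m ξ * 𝓕 (⇑f) ξ) p volume ≤
      ENNReal.ofReal C * eLpNorm (⇑f) p volume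

/-- A form of Minkowski's integral inequality over a finite measure, proved with Hölder's
inequality in place of duality. -/
lemma eLpNorm_integral_le_of_forall_le {α β : Type*} [MeasurableSpace α] [MeasurableSpace β]
    {μ : Measure α} {ν : Measure β} [SFinite μ] [SFinite ν] {p : ℝ≥0∞} (hp : 1 ≤ p) (hp' : p ≠ ∞)
    {G : α → β → ℂ} (hG : StronglyMeasurable (Function.uncurry G)) {B : α → ℝ≥0∞}
    (hB : Measurable B) {N : ℝ≥0∞} (hGB : ∀ t, eLpNorm (G t) p ν ≤ B t * N) :
    eLpNorm (fun x => ∫ t, G t x ∂μ) p ν ≤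
      μ Set.univ ^ (1 - 1 / p.toReal) * (∫⁻ t, B t ^ p.toReal ∂μ) ^ (1 / p.toReal) * N := by
  have hp0 : p ≠ 0 := (zero_lt_one.trans_le hp).ne'
  have hpr : 0 < p.toReal := ENNReal.toReal_pos hp0 hp'
  have hpow : ∀ a : ℝ≥0∞, (a ^ (1 / p.toReal)) ^ p.toReal = a := fun a => by
    rw [← ENNReal.rpow_mul, one_div_mul_cancel hpr.ne', ENNReal.rpow_one]
  have hpow' : ∀ a : ℝ≥0∞, (a ^ p.toReal) ^ (1 / p.toReal) = a := fun a => by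
    rw [← ENNReal.rpow_mul, mul_one_div_cancel hpr.ne', ENNReal.rpow_one]
  set c : ℝ≥0∞ := μ Set.univ ^ (1 - 1 / p.toReal)
  have hpt : ∀ x, ‖∫ t, G t x ∂μ‖ₑ ^ p.toReal ≤
      c ^ p.toReal * ∫⁻ t, ‖G t x‖ₑ ^ p.toReal ∂μ := fun x => by
    have hGx : AEStronglyMeasurable (fun t => G t x) μ :=
      (hG.comp_measurable measurable_prodMk_right).aestronglyMeasurable
    have h := eLpNorm_le_eLpNorm_mul_rpow_measure_univ hp hGx
    rw [eLpNorm_one_eq_lintegral_enorm, eLpNorm_eq_lintegral_rpow_enorm_toReal hp0 hp',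
      ENNReal.toReal_one, div_one] at h
    calc ‖∫ t, G t x ∂μ‖ₑ ^ p.toReal
        ≤ ((∫⁻ t, ‖G t x‖ₑ ^ p.toReal ∂μ) ^ (1 / p.toReal) * c) ^ p.toReal := by
          gcongr
          exact (enorm_integral_le_lintegral_enorm _).trans h
      _ = _ := by rw [ENNReal.mul_rpow_of_nonneg _ _ hpr.le, hpow, mul_comm]
  have hmeas : Measurable fun z : β × α => ‖G z.2 z.1‖ₑ ^ p.toReal :=
    ((hG.comp_measurable measurable_swap).enorm).pow_const _
  have hslice : ∀ t, ∫⁻ x, ‖G t x‖ₑ ^ p.toReal ∂ν ≤ B t ^ p.toReal * N ^ p.toReal := fun t => by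
    have h := hGB t
    rw [eLpNorm_eq_lintegral_rpow_enorm_toReal hp0 hp'] at h
    rw [← ENNReal.mul_rpow_of_nonneg _ _ hpr.le, ← hpow (∫⁻ x, _ ∂ν)]
    gcongr
  rw [eLpNorm_eq_lintegral_rpow_enorm_toReal hp0 hp']
  calc (∫⁻ x, ‖∫ t, G t x ∂μ‖ₑ ^ p.toReal ∂ν) ^ (1 / p.toReal)
      ≤ (c ^ p.toReal * ((∫⁻ t, B t ^ p.toReal ∂μ) * N ^ p.toReal)) ^ (1 / p.toReal) := by
        gcongr
        calc ∫⁻ x, ‖∫ t, G t x ∂μ‖ₑ ^ p.toReal ∂ν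
            ≤ ∫⁻ x, c ^ p.toReal * ∫⁻ t, ‖G t x‖ₑ ^ p.toReal ∂μ ∂ν := lintegral_mono hpt
          _ = c ^ p.toReal * ∫⁻ t, ∫⁻ x, ‖G t x‖ₑ ^ p.toReal ∂ν ∂μ := by
            rw [lintegral_const_mul _ hmeas.lintegral_prod_right',
              lintegral_lintegral_swap hmeas.aemeasurable]
          _ ≤ _ := by
            rw [← lintegral_mul_const _ (hB.pow_const _)]
            gcongr with t
            exact hslice t
    _ = _ := by
      have h0 : 0 ≤ 1 / p.toReal := by positivity
      rw [ENNReal.mul_rpow_of_nonneg _ _ h0, ENNReal.mul_rpow_of_nonneg _ _ h0, hpow', hpow',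
        mul_assoc]

lemma fourierInv_integral_mul {V α : Type*} [NormedAddCommGroup V] [InnerProductSpace ℝ V]
    [MeasurableSpace V] [BorelSpace V] [FiniteDimensional ℝ V] [MeasurableSpace α]
    {μ : Measure α} [IsFiniteMeasure μ] {k : α → V → ℂ}
    (hk : Measurable (Function.uncurry k)) {K : ℝ} (hK : ∀ t ξ, ‖k t ξ‖ ≤ K) {g : V → ℂ}
    (hg : Integrable g) (x : V) :
    𝓕⁻ (fun ξ => (∫ t, k t ξ ∂μ) * g ξ) x = ∫ t, 𝓕⁻ (fun ξ => k t ξ * g ξ) x ∂μ := by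
  simp only [Real.fourierInv_eq', smul_eq_mul, ← integral_mul_const, ← integral_const_mul]
  rw [integral_integral_swap]
  have hb : Integrable (fun z : V × α => g z.1) (volume.prod μ) := hg.comp_fst μ
  refine (hb.bdd_mul (c := K)
    (f := fun z : V × α => Complex.exp (↑(2 * Real.pi * inner ℝ z.1 x) * Complex.I) * k z.2 z.1)
    ?_ ?_).congr ?_
  · exact ((by fun_prop : Measurable fun z : V × α =>
      Complex.exp (↑(2 * Real.pi * inner ℝ z.1 x) * Complex.I)).mul
      (hk.comp measurable_swap)).aestronglyMeasurable
  · refine Filter.Eventually.of_forall fun z => ?_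
    rw [norm_mul, Complex.norm_exp_ofReal_mul_I, one_mul]
    exact hK _ _
  · exact Filter.Eventually.of_forall fun z => by simp [Function.uncurry, mul_assoc]

lemma stronglyMeasurable_fourierInv_mul {V α : Type*} [NormedAddCommGroup V]
    [InnerProductSpace ℝ V] [MeasurableSpace V] [BorelSpace V] [FiniteDimensional ℝ V]
    [MeasurableSpace α] {k : α → V → ℂ} (hk : Measurable (Function.uncurry k)) {g : V → ℂ}
    (hg : Measurable g) :
    StronglyMeasurable (Function.uncurry fun t x => 𝓕⁻ (fun ξ => k t ξ * g ξ) x) := by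
  simp only [Real.fourierInv_eq', smul_eq_mul, Function.uncurry_def]
  refine StronglyMeasurable.integral_prod_right (f := fun (z : α × V) ξ =>
    Complex.exp (↑(2 * Real.pi * inner ℝ ξ z.2) * Complex.I) * (k z.1 ξ * g ξ)) ?_
  refine Measurable.stronglyMeasurable ?_
  have h1 : Measurable fun z : (α × V) × V => k z.1.1 z.2 :=
    hk.comp (measurable_fst.fst.prodMk measurable_snd)
  have h2 : Measurable fun z : (α × V) × V => g z.2 := hg.comp measurable_snd
  have h3 : Measurable fun z : (α × V) × V =>
      Complex.exp (↑(2 * Real.pi * inner ℝ z.2 z.1.2) * Complex.I) := by fun_prop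
  exact h3.mul (h1.mul h2)

/-- An average of uniformly bounded multipliers whose multiplier constants are `p`-integrable is
a multiplier. -/
lemma multiplierBound.integral {α : Type*} [MeasurableSpace α] {μ : Measure α} [IsFiniteMeasure μ]
    {n : ℕ} {p : ℝ≥0∞} (hp : 1 ≤ p) (hp' : p ≠ ∞) {k : α → EuclideanSpace ℝ (Fin n) → ℂ}
    (hk : Measurable (Function.uncurry k)) {K : ℝ} (hK : ∀ t ξ, ‖k t ξ‖ ≤ K)
    {B : α → ℝ} (hB : Measurable B) (hkB : ∀ t, multiplierBound n p (k t) (B t))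
    (hBp : ∫⁻ t, ENNReal.ofReal (B t) ^ p.toReal ∂μ ≠ ∞) :
    ∃ C : ℝ, 0 ≤ C ∧ multiplierBound n p (fun ξ => ∫ t, k t ξ ∂μ) C := by
  have hp1 : 1 ≤ p.toReal := by simpa using ENNReal.toReal_mono hp' hp
  set D : ℝ≥0∞ := μ Set.univ ^ (1 - 1 / p.toReal) *
    (∫⁻ t, ENNReal.ofReal (B t) ^ p.toReal ∂μ) ^ (1 / p.toReal)
  have hD : D ≠ ∞ := by
    refine ENNReal.mul_ne_top (ENNReal.rpow_ne_top_of_nonneg ?_ (measure_ne_top _ _))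
      (ENNReal.rpow_ne_top_of_nonneg (by positivity) hBp)
    rw [sub_nonneg]
    exact div_le_one_of_le₀ hp1 (by positivity)
  refine ⟨D.toReal, ENNReal.toReal_nonneg, fun f => ?_⟩
  obtain ⟨g, hg⟩ : ∃ g : SchwartzMap (EuclideanSpace ℝ (Fin n)) ℂ, 𝓕 (⇑f) = ⇑g :=
    ⟨𝓕 f, (SchwartzMap.fourier_coe f).symm⟩
  rw [ENNReal.ofReal_toReal hD]
  have hgi : Integrable (𝓕 (⇑f)) := hg ▸ g.integrable
  have hgm : Measurable (𝓕 (⇑f)) := hg ▸ g.continuous.measurable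
  rw [funext (fourierInv_integral_mul hk hK hgi)]
  exact eLpNorm_integral_le_of_forall_le hp hp' (stronglyMeasurable_fourierInv_mul hk hgm)
    hB.ennreal_ofReal fun t => hkB t f

lemma multiplierBound.neg {n : ℕ} {p : ℝ≥0∞} {m : EuclideanSpace ℝ (Fin n) → ℂ} {C : ℝ}
    (h : multiplierBound n p m C) : multiplierBound n p (fun ξ => -m ξ) C := fun f => by
  have hneg : (𝓕⁻ fun ξ => -m ξ * 𝓕 (⇑f) ξ) = -𝓕⁻ fun ξ => m ξ * 𝓕 (⇑f) ξ := by
    ext x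
    simp [Real.fourierInv_eq', integral_neg]
  rw [hneg, eLpNorm_neg]
  exact h f

lemma integrableOn_exp_rpow_sub_mul {s : ℝ} (hs0 : 0 ≤ s) (hs1 : s < 1) (q : ℝ) {l : ℝ}
    (hl : 0 < l) :
    IntegrableOn (fun t : ℝ => Real.exp (q * |t| ^ s - l * t)) (Set.Ioi 0) := by
  refine integrable_of_isBigO_exp_neg (b := l / 2) (by positivity) ?_ ?_
  · exact (Real.continuous_exp.comp (((continuous_abs.rpow_const fun _ => Or.inr hs0).const_mul
      q).sub (continuous_const.mul continuous_id))).continuousOn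
  · refine Asymptotics.IsBigO.of_bound 1 ?_
    have hlim : Filter.Tendsto (fun t : ℝ => q * t ^ (-(1 - s))) Filter.atTop (nhds 0) := by
      simpa using (tendsto_rpow_neg_atTop (sub_pos.2 hs1)).const_mul q
    filter_upwards [hlim.eventually_le_const (half_pos hl), Filter.eventually_gt_atTop 0]
      with t ht ht0
    rw [one_mul, Real.norm_of_nonneg (Real.exp_pos _).le, Real.norm_of_nonneg (Real.exp_pos _).le,
      Real.exp_le_exp, abs_of_pos ht0]
    have hts : t ^ s = t ^ (-(1 - s)) * t := by
      rw [← Real.rpow_add_one ht0.ne']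
      ring_nf
    rw [hts]
    nlinarith [mul_le_mul_of_nonneg_right ht ht0.le]

lemma integral_exp_neg_I_mul_withDensity {l : ℝ} (hl : 0 < l) (y : ℝ) :
    ∫ t, Complex.exp (Complex.I * ↑(-t) * y)
      ∂((volume.restrict (Set.Ioi 0)).withDensity fun t => ENNReal.ofReal (Real.exp (-l * t))) =
      1 / (l + Complex.I * y) := by
  rw [integral_withDensity_eq_integral_toReal_smul (by fun_prop) (by simp)]
  have h := integral_exp_mul_complex_Ioi (a := -(l + Complex.I * y)) (by simpa using hl) 0
  simp only [Complex.ofReal_zero, mul_zero, Complex.exp_zero, neg_div_neg_eq] at h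
  rw [← h]
  refine integral_congr_ae (Filter.Eventually.of_forall fun t => ?_)
  simp only [ENNReal.toReal_ofReal (Real.exp_pos _).le, Complex.real_smul, Complex.ofReal_exp,
    ← Complex.exp_add]
  push_cast
  ring_nf

lemma exists_multiplierBound_resolvent_of_pos {n : ℕ} {p : ℝ≥0∞} (hp : 1 ≤ p) (hp' : p ≠ ∞)
    {m : EuclideanSpace ℝ (Fin n) → ℝ} (hm : Measurable m) {A s : ℝ} (hA : 0 ≤ A) (hs0 : 0 ≤ s)
    (hs1 : s < 1)
    (hmul : ∀ t : ℝ, multiplierBound n p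
      (fun ξ => Complex.exp (Complex.I * t * m ξ)) (A * Real.exp (|t| ^ s)))
    {l : ℝ} (hl : 0 < l) :
    ∃ C : ℝ, 0 ≤ C ∧ multiplierBound n p (fun ξ => 1 / (l + Complex.I * m ξ)) C := by
  set μ : Measure ℝ :=
    (volume.restrict (Set.Ioi 0)).withDensity fun t => ENNReal.ofReal (Real.exp (-l * t))
  have : IsFiniteMeasure μ := isFiniteMeasure_withDensity_ofReal
    (integrableOn_exp_mul_Ioi (neg_lt_zero.2 hl) 0).hasFiniteIntegral
  simp only [← integral_exp_neg_I_mul_withDensity hl]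
  refine multiplierBound.integral hp hp' (K := 1) (B := fun t => A * Real.exp (|t| ^ s))
    ?_ (fun t ξ => ?_) (by fun_prop) (fun t => ?_) ?_
  · simp only [Function.uncurry_def]
    fun_prop
  · rw [mul_assoc, mul_comm, ← Complex.ofReal_mul, Complex.norm_exp_ofReal_mul_I]
  · simpa using hmul (-t)
  · rw [lintegral_withDensity_eq_lintegral_mul _ (by fun_prop) (by fun_prop)]
    have hint := (integrableOn_exp_rpow_sub_mul hs0 hs1 p.toReal hl).const_mul (A ^ p.toReal)
    refine (lt_of_eq_of_lt (lintegral_congr fun t => ?_) hint.lintegral_lt_top).ne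
    rw [Pi.mul_apply, ENNReal.ofReal_rpow_of_nonneg (by positivity) ENNReal.toReal_nonneg,
      ← ENNReal.ofReal_mul (by positivity), Real.mul_rpow hA (by positivity), ← Real.exp_mul,
      mul_left_comm, ← Real.exp_add]
    ring_nf

theorem resolvent_is_multiplier
    (n : ℕ) (p : ℝ≥0∞) (hp : 1 ≤ p) (hp' : p ≠ ∞)
    (m : EuclideanSpace ℝ (Fin n) → ℝ) (hm : Measurable m)
    (A s : ℝ) (hA : 0 < A) (hs0 : 0 < s) (hs1 : s < 1)
    (hmul : ∀ t : ℝ, multiplierBound n p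
      (fun ξ => Complex.exp (Complex.I * t * m ξ)) (A * Real.exp (|t| ^ s)))
    (l : ℝ) (hl : l ≠ 0) :
    ∃ C : ℝ, 0 ≤ C ∧
      multiplierBound n p (fun ξ => 1 / (l + Complex.I * m ξ)) C := by
  rcases hl.lt_or_gt with hneg | hpos
  · obtain ⟨C, hC, h⟩ := exists_multiplierBound_resolvent_of_pos (m := fun ξ => -m ξ) hp hp' hm.neg
      hA.le hs0.le hs1 (fun t => by simpa using hmul (-t)) (neg_pos.2 hneg)
    refine ⟨C, hC, ?_⟩
    convert h.neg using 2 with ξ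
    push_cast
    rw [mul_neg, ← neg_add, div_neg, neg_neg]
  · exact exists_multiplierBound_resolvent_of_pos hp hp' hm hA.le hs0.le hs1 hmul hpos
end
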